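/- Let S_1, …, S_n ⊆ ℂ be nonempty convex sets, each invariant under complex conjugation, whose real-axis projections are closed intervals with centers c_k and half-widths r_k (k = 1,…,n). Then for any real scalars γ_1,…,γ_n, the set distance between the Minkowski sum Σ_k γ_k • S_k and the origin satisfies d(Σ_k γ_k • S_k, {0}) = max{0, |Σ_k c_k γ_k| − Σ_k r_k |γ_k|}. -/

import Mathlib

open Pointwise

/-- The distance between two sets in a metric space:
`d(A,B) := inf {dist a b : a ∈ A, b ∈ B}`. -/
noncomputable def setDist {X : Type*} [PseudoMetricSpace X] (A B : Set X) : ℝ :=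
  sInf (Set.image2 dist A B)

theorem aux_real (S : Set ℂ) (hconv : Convex ℝ S)
    (hconj : ∀ z ∈ S, (starRingEnd ℂ) z ∈ S) (z : ℂ) (hz : z ∈ S) : (z.re : ℂ) ∈ S := by
  have h := hconv hz (hconj z hz) (a := 1/2) (b := 1/2) (by norm_num) (by norm_num) (by norm_num)
  convert h using 1
  apply Complex.ext
  · simp
    ring
  · simp

theorem aux_t (C R : ℝ) (hR : 0 ≤ R) : ∃ t : ℝ, |t| ≤ 1 ∧ |C + t * R| = max 0 (|C| - R) := by
  by_cases h : |C| ≤ R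
  · rw [max_eq_left (by linarith)]
    rcases hR.eq_or_lt with h0 | h0
    · subst h0
      refine ⟨0, by simp, ?_⟩
      simpa using h
    · refine ⟨-C / R, ?_, ?_⟩
      · rw [abs_div, abs_neg, abs_of_pos h0]
        exact (div_le_one h0).2 h
      · field_simp
        simp
  · push Not at h
    rw [max_eq_right (by linarith)]
    rcases le_total 0 C with hC | hC
    · rw [abs_of_nonneg hC] at h ⊢
      refine ⟨-1, by simp, ?_⟩
      rw [abs_of_nonneg (by linarith)]
      ring
    · rw [abs_of_nonpos hC] at h ⊢
      refine ⟨1, by simp, ?_⟩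
      rw [abs_of_nonpos (by linarith)]
      ring

theorem aux_sign (g : ℝ) : ∃ s : ℝ, |s| ≤ 1 ∧ g * s = |g| := by
  rcases le_total 0 g with h | h
  · exact ⟨1, by simp, by simp [abs_of_nonneg h]⟩
  · exact ⟨-1, by simp, by simp [abs_of_nonpos h]⟩

/-- Let `S k ⊆ ℂ` (`k : Fin n`) be nonempty convex sets, invariant under
complex conjugation, whose real-axis projections are closed intervals with
centers `c k` and half-widths `r k`.  Then for real scalars `γ k`, the set
distance between the Minkowski sum `Σ_k γ_k • S_k` and the origin is
`max {0, |Σ_k c_k γ_k| − Σ_k r_k |γ_k|}`. -/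
theorem setDist_sum_smul_zero (n : ℕ) (S : Fin n → Set ℂ)
    (hS : ∀ k, (S k).Nonempty)
    (hSconv : ∀ k, Convex ℝ (S k))
    (hSconj : ∀ k, ∀ z ∈ S k, (starRingEnd ℂ) z ∈ S k)
    (lo hi : Fin n → ℝ)
    (hSproj : ∀ k, Complex.re '' (S k) = Set.Icc (lo k) (hi k))
    (c r : Fin n → ℝ)
    (hc : ∀ k, c k = (lo k + hi k) / 2)
    (hr : ∀ k, r k = (hi k - lo k) / 2)
    (γ : Fin n → ℝ) :
    setDist (∑ k, γ k • S k) {(0 : ℂ)} =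
      max 0 (|∑ k, c k * γ k| - ∑ k, r k * |γ k|) := by
  have hr0 : ∀ k, 0 ≤ r k := by
    intro k
    obtain ⟨z, hz⟩ := hS k
    have h1 : z.re ∈ Set.Icc (lo k) (hi k) := hSproj k ▸ ⟨z, hz, rfl⟩
    rw [hr]
    linarith [h1.1, h1.2]
  have hreal : ∀ k, ∀ x : ℝ, |x - c k| ≤ r k → (x : ℂ) ∈ S k := by
    intro k x hx
    rw [abs_le, hc, hr] at hx
    have h1 : x ∈ Complex.re '' S k := by
      rw [hSproj]
      constructor <;> linarith [hx.1, hx.2]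
    obtain ⟨z, hz, rfl⟩ := h1
    exact aux_real _ (hSconv k) (hSconj k) z hz
  have hlow : ∀ k, ∀ z ∈ S k, |z.re - c k| ≤ r k := by
    intro k z hz
    have h1 : z.re ∈ Set.Icc (lo k) (hi k) := hSproj k ▸ ⟨z, hz, rfl⟩
    rw [abs_le, hc, hr]
    constructor <;> linarith [h1.1, h1.2]
  have hR : 0 ≤ ∑ k, r k * |γ k| :=
    Finset.sum_nonneg fun k _ => mul_nonneg (hr0 k) (abs_nonneg _)
  refine IsLeast.csInf_eq ⟨?_, ?_⟩
  · obtain ⟨t, ht, hte⟩ := aux_t (∑ k, c k * γ k) (∑ k, r k * |γ k|) hR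
    choose s hs hse using fun k => aux_sign (γ k)
    have hmem : ∀ k, ((c k + t * s k * r k : ℝ) : ℂ) ∈ S k := by
      intro k
      apply hreal
      rw [add_sub_cancel_left, abs_mul, abs_mul, abs_of_nonneg (hr0 k)]
      exact mul_le_of_le_one_left (hr0 k) (mul_le_one₀ ht (abs_nonneg _) (hs k))
    refine ⟨∑ k, γ k • ((c k + t * s k * r k : ℝ) : ℂ), ?_, 0, rfl, ?_⟩
    · rw [Set.mem_fintype_sum]
      exact ⟨_, fun k => Set.smul_mem_smul_set (hmem k), rfl⟩
    · rw [← hte, dist_zero_right]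
      have : ∑ k, γ k • ((c k + t * s k * r k : ℝ) : ℂ)
          = ((∑ k, c k * γ k + t * ∑ k, r k * |γ k| : ℝ) : ℂ) := by
        rw [Finset.mul_sum, ← Finset.sum_add_distrib, Complex.ofReal_sum]
        refine Finset.sum_congr rfl fun k _ => ?_
        rw [← hse, Complex.real_smul, ← Complex.ofReal_mul]
        congr 1
        ring
      rw [this, Complex.norm_real, Real.norm_eq_abs]
  · rintro _ ⟨w, hw, _, rfl, rfl⟩
    refine max_le dist_nonneg ?_
    rw [dist_zero_right]
    rw [Set.mem_fintype_sum] at hw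
    obtain ⟨g, hg, rfl⟩ := hw
    choose z hz hzg using fun k => Set.mem_smul_set.1 (hg k)
    refine le_trans ?_ (Complex.abs_re_le_norm _)
    have h1 : (∑ k, g k).re = ∑ k, c k * γ k + ∑ k, ((z k).re - c k) * γ k := by
      rw [Complex.re_sum, ← Finset.sum_add_distrib]
      refine Finset.sum_congr rfl fun k _ => ?_
      rw [← hzg, Complex.smul_re, smul_eq_mul]
      ring
    have h2 : |∑ k, ((z k).re - c k) * γ k| ≤ ∑ k, r k * |γ k| := by
      refine (Finset.abs_sum_le_sum_abs _ _).trans (Finset.sum_le_sum fun k _ => ?_)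
      rw [abs_mul]
      exact mul_le_mul_of_nonneg_right (hlow k _ (hz k)) (abs_nonneg _)
    rw [h1]
    have h3 := abs_sub_abs_le_abs_sub (∑ k, c k * γ k) (-∑ k, ((z k).re - c k) * γ k)
    rw [abs_neg, sub_neg_eq_add] at h3
    linarith
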